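/- Let f be Lipschitz continuous on an open neighborhood of the closed ball B̄_ε(x), where x ∈ X and ε > 0, let 0 ∉ ∂^ε f(x), and let ã be the unique element of minimal norm in ∂^ε f(x). Then for every δ ∈ (0,1) there exists τ > 0 such that every a' ∈ ∂^ε f(x) with ‖a'‖ ≤ ‖ã‖ + τ satisfies: the direction h' := −a'/‖a'‖ fulfills f⁰_ε(x;h') = max_{a ∈ ∂^ε f(x)} ⟨a,h'⟩ < −δ‖ã‖; in particular h' is a descent direction of f on B̄_ε(x). -/

import Mathlib

open Filter Metric Set Topology MeasureTheory
open scoped RealInnerProductSpace NNReal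

variable {X : Type*} [NormedAddCommGroup X] [InnerProductSpace ℝ X] [CompleteSpace X]

/-- Clarke's generalized directional derivative. -/
noncomputable def clarkeDeriv (f : X → ℝ) (x h : X) : ℝ :=
  Filter.limsup (fun p : X × ℝ => (f (p.1 + p.2 • h) - f p.1) / p.2)
    ((𝓝 x) ×ˢ (𝓝[>] (0:ℝ)))

/-- Clarke's generalized gradient. -/
noncomputable def clarkeGrad (f : X → ℝ) (x : X) : Set X :=
  {a | ∀ h : X, ⟪a, h⟫ ≤ clarkeDeriv f x h}

/-- The gradient of `f` on the closed ball of radius `ε` about `x`. -/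
noncomputable def epsGrad (f : X → ℝ) (ε : ℝ) (x : X) : Set X :=
  closure (convexHull ℝ (⋃ y ∈ Metric.closedBall x ε, clarkeGrad f y))

/-- The directional derivative of `f` on the closed ball of radius `ε` about `x`. -/
noncomputable def epsDeriv (f : X → ℝ) (ε : ℝ) (x h : X) : ℝ :=
  sSup ((fun y => clarkeDeriv f y h) '' Metric.closedBall x ε)

omit [CompleteSpace X] in
/-- Difference quotients of a Lipschitz function are bounded near an interior point. -/
lemma eventually_abs_quotient_le {f : X → ℝ} {L : ℝ≥0} {U : Set X} (hU : IsOpen U)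
    (hf : LipschitzOnWith L f U) {y : X} (hy : y ∈ U) (h : X) :
    ∀ᶠ p : X × ℝ in (𝓝 y) ×ˢ (𝓝[>] (0:ℝ)),
      |(f (p.1 + p.2 • h) - f p.1) / p.2| ≤ L * ‖h‖ := by
  have h1 : ∀ᶠ p : X × ℝ in (𝓝 y) ×ˢ (𝓝[>] (0:ℝ)), p.1 ∈ U :=
    tendsto_fst.eventually (hU.mem_nhds hy)
  have h2 : ∀ᶠ p : X × ℝ in (𝓝 y) ×ˢ (𝓝[>] (0:ℝ)), 0 < p.2 :=
    tendsto_snd.eventually self_mem_nhdsWithin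
  have h3 : ∀ᶠ p : X × ℝ in (𝓝 y) ×ˢ (𝓝[>] (0:ℝ)), p.1 + p.2 • h ∈ U := by
    have ht : Tendsto (fun p : X × ℝ => p.1 + p.2 • h) ((𝓝 y) ×ˢ (𝓝[>] (0:ℝ))) (𝓝 y) := by
      have := (tendsto_fst (f := 𝓝 y) (g := 𝓝[>] (0:ℝ))).add
        ((tendsto_snd.mono_right nhdsWithin_le_nhds).smul_const h)
      simpa using this
    exact ht.eventually (hU.mem_nhds hy)
  filter_upwards [h1, h2, h3] with p hp hpos hp'
  rw [abs_div, abs_of_pos hpos, div_le_iff₀ hpos]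
  have := hf.dist_le_mul _ hp' _ hp
  rw [Real.dist_eq, dist_eq_norm, add_sub_cancel_left, norm_smul, Real.norm_eq_abs,
    abs_of_pos hpos] at this
  linarith

omit [CompleteSpace X] in
lemma clarkeDeriv_le_of_eventually {f : X → ℝ} {L : ℝ≥0} {U : Set X} (hU : IsOpen U)
    (hf : LipschitzOnWith L f U) {y : X} (hy : y ∈ U) {h : X} {c : ℝ}
    (hc : ∀ᶠ p : X × ℝ in (𝓝 y) ×ˢ (𝓝[>] (0:ℝ)), (f (p.1 + p.2 • h) - f p.1) / p.2 ≤ c) :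
    clarkeDeriv f y h ≤ c := by
  refine limsup_le_of_le ?_ hc
  refine IsBoundedUnder.isCoboundedUnder_le ⟨-(L * ‖h‖), ?_⟩
  exact (eventually_abs_quotient_le hU hf hy h).mono fun p hp => (abs_le.1 hp).1

omit [CompleteSpace X] in
lemma eventually_lt_of_clarkeDeriv_lt {f : X → ℝ} {L : ℝ≥0} {U : Set X} (hU : IsOpen U)
    (hf : LipschitzOnWith L f U) {y : X} (hy : y ∈ U) {h : X} {c : ℝ}
    (hc : clarkeDeriv f y h < c) :
    ∀ᶠ p : X × ℝ in (𝓝 y) ×ˢ (𝓝[>] (0:ℝ)), (f (p.1 + p.2 • h) - f p.1) / p.2 < c :=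
  eventually_lt_of_limsup_lt hc
    ⟨L * ‖h‖, (eventually_abs_quotient_le hU hf hy h).mono fun _ hp => (abs_le.1 hp).2⟩

omit [CompleteSpace X] in
lemma clarkeDeriv_le {f : X → ℝ} {L : ℝ≥0} {U : Set X} (hU : IsOpen U)
    (hf : LipschitzOnWith L f U) {y : X} (hy : y ∈ U) (h : X) :
    clarkeDeriv f y h ≤ L * ‖h‖ :=
  clarkeDeriv_le_of_eventually hU hf hy
    ((eventually_abs_quotient_le hU hf hy h).mono fun _ hp => (abs_le.1 hp).2)

omit [CompleteSpace X] in
lemma clarkeDeriv_add_le {f : X → ℝ} {L : ℝ≥0} {U : Set X} (hU : IsOpen U)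
    (hf : LipschitzOnWith L f U) {y : X} (hy : y ∈ U) (h k : X) :
    clarkeDeriv f y (h + k) ≤ clarkeDeriv f y h + clarkeDeriv f y k := by
  refine le_of_forall_pos_le_add fun e he => ?_
  have h1 := eventually_lt_of_clarkeDeriv_lt hU hf hy
    (show clarkeDeriv f y h < clarkeDeriv f y h + e / 2 by linarith)
  have h2 := eventually_lt_of_clarkeDeriv_lt hU hf hy
    (show clarkeDeriv f y k < clarkeDeriv f y k + e / 2 by linarith)
  have ht : Tendsto (fun p : X × ℝ => (p.1 + p.2 • h, p.2)) ((𝓝 y) ×ˢ (𝓝[>] (0:ℝ)))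
      ((𝓝 y) ×ˢ (𝓝[>] (0:ℝ))) := by
    refine Tendsto.prodMk ?_ tendsto_snd
    have := (tendsto_fst (f := 𝓝 y) (g := 𝓝[>] (0:ℝ))).add
      ((tendsto_snd.mono_right nhdsWithin_le_nhds).smul_const h)
    simpa using this
  refine clarkeDeriv_le_of_eventually hU hf hy ?_
  filter_upwards [h1, ht.eventually h2] with p hp hp'
  have : (f (p.1 + p.2 • (h + k)) - f p.1) / p.2
      = (f (p.1 + p.2 • h) - f p.1) / p.2
        + (f (p.1 + p.2 • h + p.2 • k) - f (p.1 + p.2 • h)) / p.2 := by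
    rw [smul_add, ← add_assoc]; ring
  rw [this]
  linarith

omit [CompleteSpace X] in
lemma clarkeDeriv_smul_le {f : X → ℝ} {L : ℝ≥0} {U : Set X} (hU : IsOpen U)
    (hf : LipschitzOnWith L f U) {y : X} (hy : y ∈ U) {c : ℝ} (hc : 0 < c) (h : X) :
    clarkeDeriv f y (c • h) ≤ c * clarkeDeriv f y h := by
  refine le_of_forall_pos_le_add fun e he => ?_
  have h1 := eventually_lt_of_clarkeDeriv_lt hU hf hy
    (show clarkeDeriv f y h < clarkeDeriv f y h + e / c by linarith [div_pos he hc])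
  have hm : Tendsto (fun t : ℝ => t * c) (𝓝[>] 0) (𝓝[>] 0) := by
    refine tendsto_nhdsWithin_iff.2 ⟨?_, ?_⟩
    · have : Tendsto (fun t : ℝ => t * c) (𝓝 0) (𝓝 (0 * c)) := tendsto_id.mul_const c
      rw [zero_mul] at this
      exact this.mono_left nhdsWithin_le_nhds
    · filter_upwards [self_mem_nhdsWithin] with t ht using mul_pos ht hc
  have ht : Tendsto (fun p : X × ℝ => (p.1, p.2 * c)) ((𝓝 y) ×ˢ (𝓝[>] (0:ℝ)))
      ((𝓝 y) ×ˢ (𝓝[>] (0:ℝ))) := tendsto_fst.prodMk (hm.comp tendsto_snd)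
  refine clarkeDeriv_le_of_eventually hU hf hy ?_
  filter_upwards [ht.eventually h1] with p hp
  have hp : (f (p.1 + (p.2 * c) • h) - f p.1) / (p.2 * c) < clarkeDeriv f y h + e / c := hp
  have hq : (f (p.1 + p.2 • c • h) - f p.1) / p.2
      = c * ((f (p.1 + (p.2 * c) • h) - f p.1) / (p.2 * c)) := by
    rw [smul_smul, mul_comm p.2 c, ← mul_div_assoc, mul_div_mul_left _ _ hc.ne']
  have hr : c * (clarkeDeriv f y h + e / c) = c * clarkeDeriv f y h + e := by
    field_simp
  rw [hq, ← hr]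
  exact mul_le_mul_of_nonneg_left hp.le hc.le

/-- A positively homogeneous, subadditive functional bounded by a multiple of the norm is, in each
direction, the maximum of the vectors it dominates. -/
lemma exists_inner_le_sublinear_eq {p : X → ℝ} {L : ℝ}
    (hsmul : ∀ c : ℝ, 0 < c → ∀ h, p (c • h) ≤ c * p h)
    (hadd : ∀ h k, p (h + k) ≤ p h + p k) (hbd : ∀ h, p h ≤ L * ‖h‖) (h : X) :
    ∃ b : X, (∀ k, ⟪b, k⟫ ≤ p k) ∧ ⟪b, h⟫ = p h := by
  have hhom : ∀ c : ℝ, 0 < c → ∀ h, p (c • h) = c * p h := by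
    intro c hc h
    refine le_antisymm (hsmul c hc h) ?_
    have := hsmul c⁻¹ (inv_pos.2 hc) (c • h)
    rw [smul_smul, inv_mul_cancel₀ hc.ne', one_smul] at this
    calc c * p h ≤ c * (c⁻¹ * p (c • h)) := mul_le_mul_of_nonneg_left this hc.le
      _ = p (c • h) := by field_simp
  have hzero : p 0 = 0 := by
    have := hhom 2 two_pos 0
    rw [smul_zero] at this
    linarith
  have hneg : 0 ≤ p h + p (-h) := by
    have := hadd h (-h)
    rwa [add_neg_cancel, hzero] at this
  obtain ⟨g, hgh, hg⟩ : ∃ g : X →ₗ[ℝ] ℝ, g h = p h ∧ ∀ k, g k ≤ p k := by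
    by_cases h0 : h = 0
    · obtain ⟨g, -, hg⟩ := exists_extension_of_le_sublinear (⊥ : X →ₗ.[ℝ] ℝ) p hhom hadd (by
        rintro ⟨v, hv⟩
        obtain rfl : v = 0 := (Submodule.mem_bot ℝ).1 hv
        have : (⟨0, hv⟩ : (⊥ : X →ₗ.[ℝ] ℝ).domain) = 0 := rfl
        rw [this, LinearPMap.map_zero]
        exact hzero.ge)
      exact ⟨g, by simp [h0, hzero], hg⟩
    · obtain ⟨g, hgf, hg⟩ := exists_extension_of_le_sublinear
        (LinearPMap.mkSpanSingleton h (p h) h0) p hhom hadd (by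
        rintro ⟨v, hv⟩
        obtain ⟨c, rfl⟩ := Submodule.mem_span_singleton.1 hv
        rw [LinearPMap.mkSpanSingleton'_apply, RingHom.id_apply, smul_eq_mul]
        rcases lt_trichotomy c 0 with hc | rfl | hc
        · have := hhom (-c) (neg_pos.2 hc) (-h)
          rw [neg_smul_neg] at this
          change c * p h ≤ p (c • h)
          rw [this]
          nlinarith
        · simp [hzero]
        · exact (hhom c hc h).ge)
      refine ⟨g, ?_, hg⟩
      have := hgf ⟨h, Submodule.mem_span_singleton_self h⟩
      rwa [LinearPMap.mkSpanSingleton_apply ℝ ℝ h0] at this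
  have hb : ∀ k, ‖g k‖ ≤ L * ‖k‖ := by
    intro k
    rw [Real.norm_eq_abs, abs_le]
    have h1 := (hg (-k)).trans (hbd (-k))
    rw [map_neg, norm_neg] at h1
    exact ⟨by linarith, (hg k).trans (hbd k)⟩
  refine ⟨(InnerProductSpace.toDual ℝ X).symm (g.mkContinuous L hb), fun k => ?_, ?_⟩
  · rw [InnerProductSpace.toDual_symm_apply]; exact hg k
  · rw [InnerProductSpace.toDual_symm_apply]; exact hgh

omit [CompleteSpace X] in
lemma bddAbove_clarkeDeriv {f : X → ℝ} {L : ℝ≥0} {U : Set X} (hU : IsOpen U)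
    (hf : LipschitzOnWith L f U) {x : X} {ε : ℝ} (hBU : closedBall x ε ⊆ U) (h : X) :
    BddAbove ((fun y => clarkeDeriv f y h) '' closedBall x ε) := by
  refine ⟨L * ‖h‖, ?_⟩
  rintro _ ⟨y, hy, rfl⟩
  exact clarkeDeriv_le hU hf (hBU hy) h

omit [CompleteSpace X] in
lemma clarkeDeriv_le_epsDeriv {f : X → ℝ} {L : ℝ≥0} {U : Set X} (hU : IsOpen U)
    (hf : LipschitzOnWith L f U) {x : X} {ε : ℝ} (hBU : closedBall x ε ⊆ U) {y : X}
    (hy : y ∈ closedBall x ε) (h : X) : clarkeDeriv f y h ≤ epsDeriv f ε x h :=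
  le_csSup (bddAbove_clarkeDeriv hU hf hBU h) ⟨y, hy, rfl⟩

omit [CompleteSpace X] in
lemma epsDeriv_le {f : X → ℝ} {x : X} {ε : ℝ} (hε : 0 ≤ ε) {h : X} {c : ℝ}
    (hc : ∀ y ∈ closedBall x ε, clarkeDeriv f y h ≤ c) : epsDeriv f ε x h ≤ c := by
  refine csSup_le ((nonempty_closedBall.2 hε).image _) ?_
  rintro _ ⟨y, hy, rfl⟩
  exact hc y hy

omit [CompleteSpace X] in
lemma inner_le_epsDeriv {f : X → ℝ} {L : ℝ≥0} {U : Set X} (hU : IsOpen U)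
    (hf : LipschitzOnWith L f U) {x : X} {ε : ℝ} (hBU : closedBall x ε ⊆ U) {b : X}
    (hb : b ∈ epsGrad f ε x) (h : X) : ⟪b, h⟫ ≤ epsDeriv f ε x h := by
  have hclosed : IsClosed {b : X | ⟪b, h⟫ ≤ epsDeriv f ε x h} :=
    isClosed_le (by fun_prop) continuous_const
  have hconv : Convex ℝ {b : X | ⟪b, h⟫ ≤ epsDeriv f ε x h} :=
    convex_halfSpace_le
      ⟨fun u v => inner_add_left u v h, fun c u => real_inner_smul_left u h c⟩ _
  refine closure_minimal (convexHull_min ?_ hconv) hclosed hb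
  intro c hc
  obtain ⟨y, hy, hcy⟩ := mem_iUnion₂.1 hc
  exact (hcy h).trans (clarkeDeriv_le_epsDeriv hU hf hBU hy h)

/-- The support function of the gradient on a ball is the directional derivative on the ball, and
the supremum is attained. -/
lemma isGreatest_epsDeriv {f : X → ℝ} {L : ℝ≥0} {U : Set X} (hU : IsOpen U)
    (hf : LipschitzOnWith L f U) {x : X} {ε : ℝ} (hε : 0 ≤ ε) (hBU : closedBall x ε ⊆ U)
    (h : X) : IsGreatest ((fun b => ⟪b, h⟫) '' epsGrad f ε x) (epsDeriv f ε x h) := by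
  refine ⟨?_, ?_⟩
  · obtain ⟨b, hb, hbh⟩ := exists_inner_le_sublinear_eq (p := epsDeriv f ε x) (L := L)
      (fun c hc h => epsDeriv_le hε fun y hy =>
        (clarkeDeriv_smul_le hU hf (hBU hy) hc h).trans
          (mul_le_mul_of_nonneg_left (clarkeDeriv_le_epsDeriv hU hf hBU hy h) hc.le))
      (fun h k => epsDeriv_le hε fun y hy =>
        (clarkeDeriv_add_le hU hf (hBU hy) h k).trans
          (add_le_add (clarkeDeriv_le_epsDeriv hU hf hBU hy h)
            (clarkeDeriv_le_epsDeriv hU hf hBU hy k)))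
      (fun h => epsDeriv_le hε fun y hy => clarkeDeriv_le hU hf (hBU hy) h) h
    refine ⟨b, ?_, hbh⟩
    by_contra hmem
    obtain ⟨g, u, hgu, hub⟩ := geometric_hahn_banach_closed_point
      (convex_convexHull ℝ (⋃ y ∈ closedBall x ε, clarkeGrad f y)).closure isClosed_closure hmem
    set w := (InnerProductSpace.toDual ℝ X).symm g with hw
    have hgw : ∀ k, g k = ⟪k, w⟫ := fun k => by
      rw [real_inner_comm, hw, InnerProductSpace.toDual_symm_apply]
    have : epsDeriv f ε x w ≤ u := epsDeriv_le hε fun y hy => by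
      obtain ⟨c, hc, hcw⟩ := exists_inner_le_sublinear_eq (p := clarkeDeriv f y) (L := L)
        (fun c hc h => clarkeDeriv_smul_le hU hf (hBU hy) hc h)
        (clarkeDeriv_add_le hU hf (hBU hy)) (clarkeDeriv_le hU hf (hBU hy)) w
      have := hgu c (subset_closure (subset_convexHull ℝ _ (mem_iUnion₂.2 ⟨y, hy, hc⟩)))
      rw [hgw, hcw] at this
      exact this.le
    rw [hgw] at hub
    linarith [hb w]
  · rintro _ ⟨b, hb, rfl⟩
    exact inner_le_epsDeriv hU hf hBU hb h

omit [CompleteSpace X] in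
lemma norm_le_of_mem_epsGrad {f : X → ℝ} {L : ℝ≥0} {U : Set X} (hU : IsOpen U)
    (hf : LipschitzOnWith L f U) {x : X} {ε : ℝ} (hε : 0 ≤ ε) (hBU : closedBall x ε ⊆ U)
    {b : X} (hb : b ∈ epsGrad f ε x) : ‖b‖ ≤ L := by
  have h1 := (inner_le_epsDeriv hU hf hBU hb b).trans
    (epsDeriv_le hε fun y hy => clarkeDeriv_le hU hf (hBU hy) b)
  rw [real_inner_self_eq_norm_mul_norm] at h1
  rcases (norm_nonneg b).eq_or_lt with h0 | h0
  · rw [← h0]; exact L.2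
  · exact le_of_mul_le_mul_right h1 h0

omit [CompleteSpace X] in
lemma sq_norm_le_inner_of_minimal_norm {C : Set X} (hC : Convex ℝ C) {a b : X} (ha : a ∈ C)
    (hmin : ∀ c ∈ C, ‖a‖ ≤ ‖c‖) (hb : b ∈ C) : ‖a‖ ^ 2 ≤ ⟪b, a⟫ := by
  have : Nonempty C := ⟨⟨a, ha⟩⟩
  have hinf : ‖0 - a‖ = ⨅ w : C, ‖0 - (w : X)‖ := by
    refine le_antisymm (le_ciInf fun w => by simpa using hmin w w.2) ?_
    exact ciInf_le ⟨0, by rintro _ ⟨w, rfl⟩; exact norm_nonneg _⟩ (⟨a, ha⟩ : C)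
  have := (norm_eq_iInf_iff_real_inner_le_zero hC ha).1 hinf b hb
  rw [zero_sub, inner_neg_left, inner_sub_right, real_inner_self_eq_norm_sq,
    real_inner_comm] at this
  linarith

/-- Corollary 2.5: stability of descent directions obtained from near-minimal elements. -/
theorem descent_of_near_minimal_norm
    (f : X → ℝ) (x : X) (ε : ℝ) (hε : 0 < ε) (L : ℝ≥0) (U : Set X)
    (hU : IsOpen U) (hBU : Metric.closedBall x ε ⊆ U)
    (hf : LipschitzOnWith L f U)
    (hreg : (0 : X) ∉ epsGrad f ε x)
    (a : X) (ha : a ∈ epsGrad f ε x) (hamin : ∀ b ∈ epsGrad f ε x, ‖a‖ ≤ ‖b‖) :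
    ∀ δ : ℝ, δ ∈ Set.Ioo (0:ℝ) 1 →
      ∃ τ > (0:ℝ), ∀ a' ∈ epsGrad f ε x, ‖a'‖ ≤ ‖a‖ + τ →
        IsGreatest ((fun b => ⟪b, -(‖a'‖⁻¹ • a')⟫) '' epsGrad f ε x)
          (epsDeriv f ε x (-(‖a'‖⁻¹ • a'))) ∧
        epsDeriv f ε x (-(‖a'‖⁻¹ • a')) < -δ * ‖a‖ := by
  rintro δ ⟨hδ0, hδ⟩
  have hm : 0 < ‖a‖ := norm_pos_iff.2 fun h => hreg (h ▸ ha)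
  have hconv : Convex ℝ (epsGrad f ε x) := (convex_convexHull ℝ _).closure
  obtain ⟨τ, hτ, hτpos⟩ : ∃ τ : ℝ, δ * ‖a‖ * (‖a‖ + τ)
      < ‖a‖ ^ 2 - L * √((‖a‖ + τ) ^ 2 - ‖a‖ ^ 2) ∧ 0 < τ := by
    have h1 : Continuous fun τ : ℝ => δ * ‖a‖ * (‖a‖ + τ) := by fun_prop
    have h2 : Continuous fun τ : ℝ => ‖a‖ ^ 2 - L * √((‖a‖ + τ) ^ 2 - ‖a‖ ^ 2) := by fun_prop
    have h3 : ∀ᶠ τ in 𝓝 (0:ℝ), δ * ‖a‖ * (‖a‖ + τ)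
        < ‖a‖ ^ 2 - L * √((‖a‖ + τ) ^ 2 - ‖a‖ ^ 2) := by
      refine h1.continuousAt.eventually_lt h2.continuousAt ?_
      simp only [add_zero, sub_self, Real.sqrt_zero, mul_zero, sub_zero]
      nlinarith [mul_pos hm hm]
    exact ((h3.filter_mono nhdsWithin_le_nhds).and
      (self_mem_nhdsWithin : Ioi (0:ℝ) ∈ 𝓝[>] 0)).exists
  refine ⟨τ, hτpos, fun a' ha' hle => ?_⟩
  have hgr := isGreatest_epsDeriv hU hf hε.le hBU (-(‖a'‖⁻¹ • a'))
  refine ⟨hgr, ?_⟩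
  obtain ⟨b, hb, hbe⟩ := hgr.1
  have ha'pos : 0 < ‖a'‖ := hm.trans_le (hamin a' ha')
  have hdist : ‖a' - a‖ ≤ √((‖a‖ + τ) ^ 2 - ‖a‖ ^ 2) := by
    refine Real.le_sqrt_of_sq_le ?_
    rw [norm_sub_sq_real]
    have h1 := sq_norm_le_inner_of_minimal_norm hconv ha hamin ha'
    have h2 : ‖a'‖ ^ 2 ≤ (‖a‖ + τ) ^ 2 := pow_le_pow_left₀ ha'pos.le hle 2
    linarith
  have hinner : δ * ‖a‖ * ‖a'‖ < ⟪b, a'⟫ := by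
    have h1 := sq_norm_le_inner_of_minimal_norm hconv ha hamin hb
    have h2 : -⟪b, a' - a⟫ ≤ L * √((‖a‖ + τ) ^ 2 - ‖a‖ ^ 2) :=
      (neg_le_abs _).trans <| (abs_real_inner_le_norm b (a' - a)).trans <|
        mul_le_mul (norm_le_of_mem_epsGrad hU hf hε.le hBU hb) hdist (norm_nonneg _) L.2
    have h3 : δ * ‖a‖ * ‖a'‖ ≤ δ * ‖a‖ * (‖a‖ + τ) :=
      mul_le_mul_of_nonneg_left hle (mul_pos hδ0 hm).le
    rw [inner_sub_right] at h2
    linarith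
  rw [← hbe]
  change ⟪b, -(‖a'‖⁻¹ • a')⟫ < -δ * ‖a‖
  rw [inner_neg_right, real_inner_smul_right, neg_mul, neg_lt_neg_iff, inv_mul_eq_div,
    lt_div_iff₀ ha'pos]
  exact hinner
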